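/- arXiv:2011.14877 — 4 statements merged into one kernel-verified Lean document; each statement's English description precedes it below -/
import Mathlib

section
/- Let μ be a σ-finite Borel measure on ℝ^N and let k be an integer with 1 ≤ k ≤ N − 1. Suppose that μ(A) = 0 for every (k − 1)-dimensional affine subspace A ⊂ ℝ^N (for k = 1 this means μ has no point masses: μ({a}) = 0 for every a ∈ ℝ^N). Then the set 𝔛_k of k-dimensional affine subspaces E of ℝ^N such that μ(E) > 0 is at most countable. -/
/-- `A ⊆ ℝᴺ` is an affine subspace of dimension `k`, i.e. `A = a + L`
for some point `a` and some `k`-dimensional linear subspace `L`. -/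
def IsAffineOfDim (N k : ℕ) (A : Set (EuclideanSpace ℝ (Fin N))) : Prop :=
  ∃ (a : EuclideanSpace ℝ (Fin N)) (L : Submodule ℝ (EuclideanSpace ℝ (Fin N))),
    Module.finrank ℝ L = k ∧ A = (a + ·) '' (L : Set (EuclideanSpace ℝ (Fin N)))

theorem Submodule.exists_le_finrank_eq {K V : Type*} [DivisionRing K] [AddCommGroup V]
    [Module K V] [FiniteDimensional K V] (S : Submodule K V) {n : ℕ}
    (hS : Module.finrank K S ≤ n) (hn : n ≤ Module.finrank K V) :
    ∃ M : Submodule K V, S ≤ M ∧ Module.finrank K M = n := by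
  induction n, hS using Nat.le_induction with
  | base => exact ⟨S, le_rfl, rfl⟩
  | succ m _ ih =>
    obtain ⟨M, hSM, hM⟩ := ih (by lia)
    have hlt : M < ⊤ := lt_top_iff_ne_top.2 fun h => by
      rw [h, finrank_top] at hM
      lia
    obtain ⟨v, -, hv⟩ := SetLike.exists_of_lt hlt
    exact ⟨M ⊔ Submodule.span K {v}, hSM.trans le_sup_left,
      by rw [Submodule.finrank_sup_span_singleton hv, hM]⟩

theorem Submodule.image_add_left_eq_of_mem {R V : Type*} [Ring R] [AddCommGroup V] [Module R V]
    (L : Submodule R V) {a p : V} (hp : p ∈ (a + ·) '' (L : Set V)) :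
    (a + ·) '' (L : Set V) = (p + ·) '' (L : Set V) := by
  obtain ⟨l, hl, rfl⟩ := hp
  ext x
  constructor
  · rintro ⟨y, hy, rfl⟩
    exact ⟨y - l, L.sub_mem hy hl, by simp only; abel⟩
  · rintro ⟨y, hy, rfl⟩
    exact ⟨l + y, L.add_mem hl hy, by simp only; abel⟩

theorem IsAffineOfDim.measurableSet {N k : ℕ} {E : Set (EuclideanSpace ℝ (Fin N))}
    (hE : IsAffineOfDim N k E) : MeasurableSet E := by
  obtain ⟨a, L, -, rfl⟩ := hE
  exact ((Homeomorph.addLeft a).isClosedMap _ L.closed_of_finiteDimensional).measurableSet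

theorem IsAffineOfDim.exists_inter_subset {N k : ℕ} {E F : Set (EuclideanSpace ℝ (Fin N))}
    (hE : IsAffineOfDim N k E) (hF : IsAffineOfDim N k F) (hne : E ≠ F)
    (hEF : (E ∩ F).Nonempty) : ∃ A, IsAffineOfDim N (k - 1) A ∧ E ∩ F ⊆ A := by
  obtain ⟨a, L, hL, rfl⟩ := hE
  obtain ⟨b, M, hM, rfl⟩ := hF
  obtain ⟨p, hpL, hpM⟩ := hEF
  rw [L.image_add_left_eq_of_mem hpL, M.image_add_left_eq_of_mem hpM] at hne ⊢
  have hlt : L ⊓ M < L := inf_le_left.lt_of_ne fun h => hne <| by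
    rw [Submodule.eq_of_le_of_finrank_eq (inf_eq_left.1 h) (hL.trans hM.symm)]
  have hrank := Submodule.finrank_lt_finrank_of_lt hlt
  have hle := L.finrank_le
  rw [hL] at hrank hle
  obtain ⟨S, hS, hSrank⟩ := (L ⊓ M).exists_le_finrank_eq (n := k - 1)
    (Nat.le_sub_one_of_lt hrank) ((Nat.sub_le k 1).trans hle)
  refine ⟨_, ⟨p, S, hSrank, rfl⟩, ?_⟩
  rw [← Set.image_inter (add_right_injective p)]
  exact Set.image_mono hS

theorem stmt4 (N k : ℕ) (hk1 : 1 ≤ k) (hk2 : k ≤ N - 1)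
    (μ : MeasureTheory.Measure (EuclideanSpace ℝ (Fin N)))
    [MeasureTheory.SigmaFinite μ]
    (h0 : ∀ A : Set (EuclideanSpace ℝ (Fin N)), IsAffineOfDim N (k - 1) A → μ A = 0) :
    {E : Set (EuclideanSpace ℝ (Fin N)) | IsAffineOfDim N k E ∧ 0 < μ E}.Countable := by
  have hcount := MeasureTheory.Measure.countable_meas_pos_of_disjoint_iUnion₀ (μ := μ)
    (As := fun E : {E // IsAffineOfDim N k E} => E.1)
    (fun E => E.2.measurableSet.nullMeasurableSet) fun E F hne => by
      change μ (E.1 ∩ F.1) = 0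
      rcases (E.1 ∩ F.1).eq_empty_or_nonempty with h | h
      · rw [h, MeasureTheory.measure_empty]
      · obtain ⟨A, hA, hsub⟩ :=
          E.2.exists_inter_subset F.2 (fun h => hne (Subtype.ext h)) h
        exact MeasureTheory.measure_mono_null hsub (h0 A hA)
  refine (hcount.image Subtype.val).mono ?_
  rintro E ⟨hE, hpos⟩
  exact ⟨⟨E, hE⟩, hpos, rfl⟩
end

section
/- Let μ be a σ-finite Borel measure on ℝ^N without point masses, i.e. μ({a}) = 0 for every a ∈ ℝ^N. Then there exists an orthonormal basis e_1, …, e_N of ℝ^N such that μ(E) = 0 for every (N − 1)-dimensional affine subspace E of ℝ^N orthogonal to an element of this basis. -/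
open MeasureTheory Module

/-- A countable family of proper subspaces of a finite-dimensional real vector space does not
cover it. -/
theorem exists_forall_notMem_of_countable {E : Type*} [NormedAddCommGroup E]
    [InnerProductSpace ℝ E] [FiniteDimensional ℝ E] {S : Set (Submodule ℝ E)}
    (hS : S.Countable) (hne : ∀ V ∈ S, V ≠ ⊤) : ∃ x : E, ∀ V ∈ S, x ∉ V := by
  borelize E
  have h0 : (volume : Measure E) (⋃ V ∈ S, (V : Set E)) = 0 :=
    (measure_biUnion_null_iff hS).2 fun V hV => Measure.addHaar_submodule _ V (hne V hV)
  by_contra! hcover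
  have huniv : (⋃ V ∈ S, (V : Set E)) = Set.univ :=
    Set.eq_univ_of_forall fun x => by simpa using hcover x
  rw [huniv] at h0
  exact NeZero.ne _ (Measure.measure_univ_eq_zero.1 h0)

/-- Extend an orthonormal basis of the orthogonal complement of a unit vector by that vector. -/
theorem OrthonormalBasis.exists_cons {E : Type*} [NormedAddCommGroup E]
    [InnerProductSpace ℝ E] [FiniteDimensional ℝ E] {n : ℕ} (hn : finrank ℝ E = n + 1)
    {u : E} (hu : ‖u‖ = 1) (b : OrthonormalBasis (Fin n) ℝ (ℝ ∙ u)ᗮ) :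
    ∃ c : OrthonormalBasis (Fin (n + 1)) ℝ E, c 0 = u ∧ ∀ j : Fin n, c j.succ = b j := by
  have hub (j : Fin n) : inner ℝ u (b j : E) = 0 :=
    Submodule.mem_orthogonal_singleton_iff_inner_right.1 (b j).2
  have hon : Orthonormal ℝ (Fin.cons u fun j => (b j : E) : Fin (n + 1) → E) := by
    refine ⟨fun i => ?_, fun i j hij => ?_⟩
    · induction i using Fin.cases with
      | zero => exact hu
      | succ j => exact b.orthonormal.1 j
    · induction i using Fin.cases with
      | zero =>
        induction j using Fin.cases with
        | zero => exact absurd rfl hij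
        | succ j => simpa using hub j
      | succ i =>
        induction j using Fin.cases with
        | zero => simpa [real_inner_comm] using hub i
        | succ j => simpa using b.orthonormal.2 fun h => hij (congrArg Fin.succ h)
  refine ⟨OrthonormalBasis.mk hon
    (hon.linearIndependent.span_eq_top_of_card_eq_finrank' (by simp [hn])).ge, ?_, ?_⟩ <;> simp

/-- A finite-dimensional Euclidean space has an orthonormal basis avoiding any given countable
family of proper subspaces. -/
theorem exists_orthonormalBasis_forall_notMem (n : ℕ) {E : Type*} [NormedAddCommGroup E]
    [InnerProductSpace ℝ E] [FiniteDimensional ℝ E] (hn : finrank ℝ E = n)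
    {S : Set (Submodule ℝ E)} (hS : S.Countable) :
    ∃ b : OrthonormalBasis (Fin n) ℝ E, ∀ V ∈ S, V ≠ ⊤ → ∀ j, b j ∉ V := by
  induction n generalizing E with
  | zero =>
    exact ⟨(stdOrthonormalBasis ℝ E).reindex (finCongr hn), fun _ _ _ j => j.elim0⟩
  | succ n ih =>
    have : Fact (finrank ℝ E = n + 1) := ⟨hn⟩
    have : Nontrivial E := nontrivial_of_finrank_pos (R := ℝ) (by omega)
    obtain ⟨x, hx⟩ := exists_forall_notMem_of_countable
      (S := (S ∪ Submodule.orthogonal '' S ∪ {⊥}) \ {⊤})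
      (((hS.union (hS.image _)).union (Set.countable_singleton _)).mono Set.sdiff_subset)
      fun V hV => hV.2
    have hx0 : x ≠ 0 := by simpa using hx ⊥ ⟨Or.inr rfl, by simp⟩
    set u : E := ‖x‖⁻¹ • x with hu_def
    have hu : ‖u‖ = 1 := norm_smul_inv_norm (𝕜 := ℝ) hx0
    have hu0 : u ≠ 0 := norm_ne_zero_iff.1 (by simp [hu])
    have hu_mem (V : Submodule ℝ E) : u ∈ V ↔ x ∈ V :=
      V.smul_mem_iff (inv_ne_zero (norm_ne_zero_iff.2 hx0))
    obtain ⟨b, hb⟩ := ih (E := (ℝ ∙ u)ᗮ) (Submodule.finrank_orthogonal_span_singleton hu0)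
      (hS.image (Submodule.comap (ℝ ∙ u)ᗮ.subtype))
    obtain ⟨c, hc0, hc⟩ := OrthonormalBasis.exists_cons hn hu b
    refine ⟨c, fun V hV hVtop => Fin.cases ?_ fun j => ?_⟩
    · rw [hc0, hu_mem]
      exact hx V ⟨Or.inl (Or.inl hV), hVtop⟩
    · rw [hc]
      refine hb _ (Set.mem_image_of_mem _ hV) (fun htop => ?_) j
      have hle : (ℝ ∙ u)ᗮ ≤ V := Submodule.comap_subtype_eq_top.1 htop
      have hVorth : Vᗮ ≤ ℝ ∙ u := by
        simpa using Submodule.orthogonal_le hle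
      have hVtop' : Vᗮ ≠ ⊤ := fun h => by
        rw [Submodule.orthogonal_eq_top_iff] at h
        subst h
        have hbj : (b j : E) = 0 := by simpa using hle (b j).2
        exact b.orthonormal.ne_zero j (Subtype.ext hbj)
      obtain ⟨y, hyV, hy0⟩ := Submodule.exists_mem_ne_zero_of_ne_bot
        (fun h => hVtop (Submodule.orthogonal_eq_bot_iff.1 h) : Vᗮ ≠ ⊥)
      obtain ⟨r, rfl⟩ := Submodule.mem_span_singleton.1 (hVorth hyV)
      have hr : r ≠ 0 := fun h => hy0 (by simp [h])
      exact hx Vᗮ ⟨Or.inl (Or.inr (Set.mem_image_of_mem _ hV)), hVtop'⟩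
        ((hu_mem _).1 ((Submodule.smul_mem_iff _ hr).1 hyV))

/-- Affine subspaces that are minimal among those of positive measure. -/
def minimalNonnullAffineSubspaces {E : Type*} [NormedAddCommGroup E] [InnerProductSpace ℝ E]
    [MeasurableSpace E] (μ : Measure E) : Set (AffineSubspace ℝ E) :=
  {A | Minimal (fun B : AffineSubspace ℝ E => μ (B : Set E) ≠ 0) A}

theorem countable_minimalNonnullAffineSubspaces {E : Type*} [NormedAddCommGroup E]
    [InnerProductSpace ℝ E] [FiniteDimensional ℝ E] [MeasurableSpace E] [BorelSpace E]
    (μ : Measure E) [SFinite μ] : (minimalNonnullAffineSubspaces μ).Countable := by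
  have hmeas (A : minimalNonnullAffineSubspaces μ) :
      NullMeasurableSet ((A : AffineSubspace ℝ E) : Set E) μ :=
    (A.1.closed_of_finiteDimensional.measurableSet).nullMeasurableSet
  have hdisj : Pairwise (Function.onFun (AEDisjoint μ)
      fun A : minimalNonnullAffineSubspaces μ => ((A : AffineSubspace ℝ E) : Set E)) := by
    intro A B hAB
    by_contra hpos
    have hpos' : μ ((A.1 ⊓ B.1 : AffineSubspace ℝ E) : Set E) ≠ 0 := hpos
    have hA : A.1 ≤ B.1 := (A.2.2 hpos' inf_le_left).trans inf_le_right
    have hB : B.1 ≤ A.1 := (B.2.2 hpos' inf_le_right).trans inf_le_left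
    exact hAB (Subtype.ext (le_antisymm hA hB))
  have hcount := Measure.countable_meas_pos_of_disjoint_iUnion₀ hmeas hdisj
  rw [show {A : minimalNonnullAffineSubspaces μ | 0 < μ ((A : AffineSubspace ℝ E) : Set E)} =
    Set.univ from Set.eq_univ_of_forall fun A => pos_iff_ne_zero.2 A.2.1] at hcount
  exact Set.countable_coe_iff.1 (Set.countable_univ_iff.1 hcount)

theorem exists_le_mem_minimalNonnullAffineSubspaces {E : Type*} [NormedAddCommGroup E]
    [InnerProductSpace ℝ E] [FiniteDimensional ℝ E] [MeasurableSpace E] {μ : Measure E}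
    {A : AffineSubspace ℝ E} (hA : μ (A : Set E) ≠ 0) :
    ∃ B ≤ A, B ∈ minimalNonnullAffineSubspaces μ := by
  obtain ⟨B, ⟨hBA, hB⟩, hmin⟩ := exists_minimalFor_of_wellFoundedLT
    (fun B : AffineSubspace ℝ E => B ≤ A ∧ μ (B : Set E) ≠ 0)
    (fun B => finrank ℝ B.direction) ⟨A, le_rfl, hA⟩
  refine ⟨B, hBA, hB, fun C hC hCB => ?_⟩
  by_contra hBC
  have hlt := Submodule.finrank_lt_finrank_of_lt (AffineSubspace.direction_lt_of_nonempty
    (lt_of_le_not_ge hCB hBC) (nonempty_of_measure_ne_zero hC))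
  exact hlt.not_ge (hmin ⟨hCB.trans hBA, hC⟩ hlt.le)

theorem direction_ne_bot_of_measure_ne_zero {E : Type*} [NormedAddCommGroup E]
    [InnerProductSpace ℝ E] [MeasurableSpace E] {μ : Measure E} (hμ : ∀ a, μ {a} = 0)
    {A : AffineSubspace ℝ E} (hA : μ (A : Set E) ≠ 0) : A.direction ≠ ⊥ := by
  intro hbot
  obtain ⟨p, hp⟩ := nonempty_of_measure_ne_zero hA
  refine hA (measure_mono_null (fun q hq => ?_) (hμ p))
  have hqp := AffineSubspace.vsub_mem_direction hq hp
  rw [hbot, Submodule.mem_bot, vsub_eq_zero_iff_eq] at hqp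
  exact hqp

theorem stmt6 (N : ℕ) (μ : MeasureTheory.Measure (EuclideanSpace ℝ (Fin N)))
    [MeasureTheory.SigmaFinite μ]
    (hnoatom : ∀ a : EuclideanSpace ℝ (Fin N), μ {a} = 0) :
    ∃ b : OrthonormalBasis (Fin N) ℝ (EuclideanSpace ℝ (Fin N)),
      ∀ (a : EuclideanSpace ℝ (Fin N)) (L : Submodule ℝ (EuclideanSpace ℝ (Fin N))),
        Module.finrank ℝ L = N - 1 → (∃ j : Fin N, b j ∈ Lᗮ) →
          μ ((a + ·) '' (L : Set (EuclideanSpace ℝ (Fin N)))) = 0 := by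
  obtain ⟨b, hb⟩ := exists_orthonormalBasis_forall_notMem N finrank_euclideanSpace_fin
    ((countable_minimalNonnullAffineSubspaces μ).image fun A => A.directionᗮ)
  refine ⟨b, fun a L _ ⟨j, hj⟩ => ?_⟩
  by_contra hpos
  have hset : (a + ·) '' (L : Set (EuclideanSpace ℝ (Fin N))) = AffineSubspace.mk' a L := by
    ext x
    simp [AffineSubspace.mem_mk', sub_eq_neg_add]
  rw [hset] at hpos
  obtain ⟨A, hAL, hA⟩ := exists_le_mem_minimalNonnullAffineSubspaces hpos
  have hdir : A.direction ≤ L := by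
    simpa using AffineSubspace.direction_le hAL
  refine hb _ (Set.mem_image_of_mem _ hA) (fun htop => ?_) j (Submodule.orthogonal_le hdir hj)
  exact direction_ne_bot_of_measure_ne_zero hnoatom hA.1
    ((Submodule.orthogonal_eq_top_iff _).1 htop)
end

section
/- Let μ be a σ-finite Borel measure on ℝ^N without point masses (μ({a}) = 0 for every a ∈ ℝ^N). Then there exists an orthonormal basis e_1, …, e_N of ℝ^N such that every cube in ℝ^N with edges parallel to the directions e_1, …, e_N has boundary of μ-measure zero; that is, μ(∂Q) = 0 for every such cube Q. -/
open MeasureTheory in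
/-- In a finite-dimensional space, an s-finite measure without atoms admits a countable set of
nonzero vectors meeting the direction of every affine subspace of positive measure. -/
theorem exists_countable_directions {E : Type*} [NormedAddCommGroup E] [NormedSpace ℝ E]
    [FiniteDimensional ℝ E] [MeasurableSpace E] [BorelSpace E] (μ : Measure E) [SFinite μ]
    (hμ : ∀ a, μ {a} = 0) :
    ∃ D : Set E, D.Countable ∧ (∀ d ∈ D, d ≠ 0) ∧
      ∀ H : AffineSubspace ℝ E, μ H ≠ 0 → ∃ d ∈ D, d ∈ H.direction := by
  let S : Set (AffineSubspace ℝ E) := {V | μ V ≠ 0 ∧ ∀ W < V, μ W = 0}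
  have hS : S.Countable := by
    have h := Measure.countable_meas_pos_of_disjoint_iUnion₀ (μ := μ)
      (As := fun V : S => (V.1 : Set E))
      (fun V => (AffineSubspace.closed_of_finiteDimensional V.1).measurableSet.nullMeasurableSet)
      (by
        intro V W hVW
        change μ ((V.1 : Set E) ∩ W.1) = 0
        rw [← AffineSubspace.coe_inf]
        by_cases h : V.1 ≤ W.1
        · refine W.2.2 _ (inf_le_right.lt_of_ne fun e => hVW (Subtype.ext (h.antisymm ?_)))
          exact inf_eq_right.1 e
        · exact V.2.2 _ (inf_le_left.lt_of_ne fun e => h (inf_eq_left.1 e)))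
    rw [show {V : S | 0 < μ (V.1 : Set E)} = Set.univ from
      Set.eq_univ_of_forall fun V => pos_iff_ne_zero.2 V.2.1] at h
    exact Set.countable_coe_iff.1 (Set.countable_univ_iff.1 h)
  have hex : ∀ V ∈ S, ∃ d ∈ V.direction, d ≠ 0 := by
    intro V hV
    have hns : ¬ (V : Set E).Subsingleton := fun h => hV.1 <| by
      rcases h.eq_empty_or_singleton with h | ⟨a, h⟩
      · rw [h, measure_empty]
      · rw [h, hμ]
    obtain ⟨p, hp, q, hq, hpq⟩ := Set.not_subsingleton_iff.1 hns
    exact ⟨p - q, AffineSubspace.vsub_mem_direction hp hq, sub_ne_zero.2 hpq⟩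
  choose! f hfV hf0 using hex
  refine ⟨f '' S, hS.image f, Set.forall_mem_image.2 hf0, fun H hH => ?_⟩
  let r : AffineSubspace ℝ E → ℕ := fun V => Module.finrank ℝ V.direction
  let T : Set (AffineSubspace ℝ E) := {V | V ≤ H ∧ μ V ≠ 0}
  have hT : T.Nonempty := ⟨H, le_rfl, hH⟩
  obtain ⟨hVH, hV⟩ := Function.argminOn_mem r T hT
  set V := Function.argminOn r T hT
  have hVS : V ∈ S := by
    refine ⟨hV, fun W hW => ?_⟩
    by_contra hW0
    have hne : (W : Set E).Nonempty := by
      by_contra h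
      rw [Set.not_nonempty_iff_eq_empty.1 h, measure_empty] at hW0
      exact hW0 rfl
    have hlt : r W < r V :=
      Submodule.finrank_lt_finrank_of_lt (AffineSubspace.direction_lt_of_nonempty hW hne)
    exact Function.not_lt_argminOn r T (show W ∈ T from ⟨hW.le.trans hVH, hW0⟩) hlt
  exact ⟨f V, ⟨V, hVS, rfl⟩, AffineSubspace.direction_le hVH (hfV V hVS)⟩

open Polynomial in
/-- A countable set of nonzero vectors admits an orthonormal basis none of whose members is
orthogonal to any of them. -/
theorem exists_orthonormalBasis_inner_ne_zero {N : ℕ} {D : Set (EuclideanSpace ℝ (Fin N))}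
    (hD : D.Countable) (hD0 : ∀ d ∈ D, d ≠ 0) :
    ∃ b : OrthonormalBasis (Fin N) ℝ (EuclideanSpace ℝ (Fin N)),
      ∀ j, ∀ d ∈ D, inner ℝ (b j) d ≠ 0 := by
  -- Reflect the standard basis in the line spanned by a generic point of the moment curve.
  let P (j : Fin N) (d : EuclideanSpace ℝ (Fin N)) : ℝ[X] :=
    ∑ k : Fin N, (monomial (j + k : ℕ) (2 * d k) - monomial (k + k : ℕ) (d j))
  have hP : ∀ j, ∀ d ∈ D, P j d ≠ 0 := by
    intro j d hd h0
    have hcoeff (n : ℕ) : (∑ k : Fin N, ((if (j + k : ℕ) = n then 2 * d k else 0) -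
        if (k + k : ℕ) = n then d j else 0)) = 0 := by
      simpa [P, finsetSum_coeff, coeff_monomial] using congrArg (coeff · n) h0
    have hj : d j = 0 := by
      have h := hcoeff (j + j)
      rw [Finset.sum_eq_single j] at h
      · simp at h; linarith
      · intro k _ hk
        have : (k : ℕ) ≠ j := fun e => hk (Fin.ext e)
        rw [if_neg (by omega), if_neg (by omega), sub_zero]
      · simp
    refine hD0 d hd (PiLp.ext fun l => ?_)
    have h := hcoeff (j + l)
    rw [Finset.sum_eq_single l] at h
    · simpa [hj] using h
    · intro k _ hk
      have : (k : ℕ) ≠ l := fun e => hk (Fin.ext e)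
      rw [if_neg (by omega), hj, ite_self, sub_zero]
    · simp
  have hroots : (⋃ j : Fin N, ⋃ d ∈ D, {x : ℝ | (P j d).IsRoot x}).Countable :=
    Set.countable_iUnion fun j => hD.biUnion fun d hd =>
      (finite_setOfPred_isRoot (hP j d hd)).countable
  obtain ⟨x, hx⟩ := (Set.ne_univ_iff_exists_notMem _).1
    (fun h => Set.not_countable_univ (h ▸ hroots) :
      (⋃ j : Fin N, ⋃ d ∈ D, {x : ℝ | (P j d).IsRoot x}) ≠ Set.univ)
  simp only [Set.mem_iUnion, Set.mem_ofPred_eq, not_exists] at hx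
  let v : EuclideanSpace ℝ (Fin N) := WithLp.toLp 2 fun k => x ^ (k : ℕ)
  refine ⟨(EuclideanSpace.basisFun (Fin N) ℝ).map (Submodule.reflection (ℝ ∙ v)),
    fun j d hd h => hx j d hd ?_⟩
  have hv : v ≠ 0 := fun h => by
    have := congrArg (fun w : EuclideanSpace ℝ (Fin N) => w ⟨0, j.pos⟩) h
    simp [v] at this
  have hn : ‖v‖ ^ 2 ≠ 0 := pow_ne_zero 2 (norm_ne_zero_iff.2 hv)
  have h1 : ‖v‖ ^ 2 = ∑ k : Fin N, x ^ (k + k : ℕ) := by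
    simp [EuclideanSpace.real_norm_sq_eq, v, ← pow_mul, mul_two]
  have h2 : inner ℝ v d = ∑ k : Fin N, x ^ (k : ℕ) * d k := by
    simp [PiLp.inner_apply, v, mul_comm]
  have h3 : 2 * (x ^ (j : ℕ) / ‖v‖ ^ 2 * inner ℝ v d) - d j = 0 := by
    simpa [Submodule.reflection_singleton_apply, inner_sub_left, inner_smul_left, two_smul,
      two_mul, inner_add_left, v, EuclideanSpace.inner_single_right,
      EuclideanSpace.inner_single_left] using h
  have h4 : 2 * x ^ (j : ℕ) * inner ℝ v d - d j * ‖v‖ ^ 2 = 0 := by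
    field_simp at h3
    linarith
  rw [h1, h2, Finset.mul_sum, Finset.mul_sum, ← Finset.sum_sub_distrib] at h4
  rw [IsRoot.def, ← h4]
  simp only [P, eval_finsetSum, eval_sub, eval_monomial]
  refine Finset.sum_congr rfl fun k _ => ?_
  ring

/-- The boundary of a cube is contained in the union of the hyperplanes carrying its faces. -/
theorem frontier_cube_subset {ι E : Type*} [Fintype ι] [NormedAddCommGroup E]
    [InnerProductSpace ℝ E] (b : OrthonormalBasis ι ℝ E) (X : E) (r : ℝ) :
    frontier {y : E | ∃ s : ι → ℝ, (∀ j, |s j| ≤ r) ∧ y = X + ∑ j, s j • b j} ⊆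
      ⋃ j, {y | inner ℝ (b j) (y - X) = r} ∪ {y | inner ℝ (b j) (y - X) = -r} := by
  have hQ : {y : E | ∃ s : ι → ℝ, (∀ j, |s j| ≤ r) ∧ y = X + ∑ j, s j • b j} =
      {y | ∀ j, |inner ℝ (b j) (y - X)| ≤ r} := by
    ext y
    constructor
    · rintro ⟨s, hs, rfl⟩ j
      simpa [b.orthonormal.inner_right_fintype] using hs j
    · intro h
      exact ⟨fun j => inner ℝ (b j) (y - X), h, by rw [b.sum_repr']; abel⟩
  rw [hQ]
  intro y hy
  have hclosed : IsClosed {y | ∀ j, |inner ℝ (b j) (y - X)| ≤ r} := by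
    simp only [Set.ofPred_forall]
    exact isClosed_iInter fun j => isClosed_le (by fun_prop) continuous_const
  have hopen : IsOpen {y | ∀ j, |inner ℝ (b j) (y - X)| < r} := by
    simp only [Set.ofPred_forall]
    exact isOpen_iInter_of_finite fun j => isOpen_lt (by fun_prop) continuous_const
  rw [hclosed.frontier_eq] at hy
  by_contra hcon
  simp only [Set.mem_iUnion, Set.mem_union, Set.mem_ofPred_eq, not_exists, not_or] at hcon
  refine hy.2 (interior_maximal (fun z hz j => (hz j).le) hopen fun j => (hy.1 j).lt_of_ne ?_)
  intro h
  rcases eq_or_eq_neg_of_abs_eq h with h | h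
  · exact (hcon j).1 h
  · exact (hcon j).2 h

theorem stmt10 (N : ℕ) (μ : MeasureTheory.Measure (EuclideanSpace ℝ (Fin N)))
    [MeasureTheory.SigmaFinite μ]
    (hnoatom : ∀ a : EuclideanSpace ℝ (Fin N), μ {a} = 0) :
    ∃ b : OrthonormalBasis (Fin N) ℝ (EuclideanSpace ℝ (Fin N)),
      ∀ (X : EuclideanSpace ℝ (Fin N)) (t : ℝ), 0 < t →
        μ (frontier {y : EuclideanSpace ℝ (Fin N) |
            ∃ s : Fin N → ℝ, (∀ j, |s j| ≤ t / 2) ∧ y = X + ∑ j, s j • b j}) = 0 := by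
  obtain ⟨D, hD, hD0, hDμ⟩ := exists_countable_directions μ hnoatom
  obtain ⟨b, hb⟩ := exists_orthonormalBasis_inner_ne_zero hD hD0
  refine ⟨b, fun X t _ => MeasureTheory.measure_mono_null (frontier_cube_subset b X (t / 2)) ?_⟩
  have key (j : Fin N) (c : ℝ) : μ {y | inner ℝ (b j) (y - X) = c} = 0 := by
    by_contra h
    have hH : (AffineSubspace.mk' (X + c • b j) (ℝ ∙ b j)ᗮ : Set (EuclideanSpace ℝ (Fin N))) =
        {y | inner ℝ (b j) (y - X) = c} := by
      ext y
      simp [AffineSubspace.mem_mk', Submodule.mem_orthogonal_singleton_iff_inner_right,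
        ← sub_sub, inner_sub_right _ (y - X), inner_smul_right, sub_eq_zero]
    rw [← hH] at h
    obtain ⟨d, hd, hdir⟩ := hDμ _ h
    rw [AffineSubspace.direction_mk', Submodule.mem_orthogonal_singleton_iff_inner_right] at hdir
    exact hb j d hd hdir
  exact MeasureTheory.measure_iUnion_null fun j =>
    MeasureTheory.measure_union_null (key j _) (key j _)
end

section
/- Let V : ℝ^N → ℝ be a smooth function with compact support and let δ > 0. Then there exists a smooth function χ : ℝ^N → [0, 1] with compact support such that the function Ṽ := χ·V satisfies: (i) |V(x) − Ṽ(x)| ≤ δ for all x ∈ ℝ^N; and (ii) the sets Ω_+ = {x : Ṽ(x) > 0} and Ω_- = {x : Ṽ(x) < 0} are at positive distance, i.e. there exists ρ > 0 such that |x_+ − x_-| ≥ ρ for all x_+ ∈ Ω_+ and x_- ∈ Ω_-. -/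
/-- A smooth cutoff on the line that vanishes for `|t| ≤ δ / 2` and equals `1` for `δ ≤ |t|`. -/
noncomputable def awayFromZeroCutoff (δ t : ℝ) : ℝ :=
  Real.smoothTransition ((2 * t / δ) ^ 2 - 1)

theorem awayFromZeroCutoff_zero (δ : ℝ) : awayFromZeroCutoff δ 0 = 0 :=
  Real.smoothTransition.zero_of_nonpos (by norm_num)

theorem contDiff_awayFromZeroCutoff (δ : ℝ) :
    ContDiff ℝ (⊤ : ℕ∞) (awayFromZeroCutoff δ) :=
  Real.smoothTransition.contDiff.comp (by fun_prop)

theorem awayFromZeroCutoff_of_le {δ t : ℝ} (hδ : 0 < δ) (ht : δ ≤ |t|) :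
    awayFromZeroCutoff δ t = 1 := by
  apply Real.smoothTransition.one_of_one_le
  have h : 2 ≤ |2 * t / δ| := by
    rw [abs_div, abs_mul, abs_of_pos hδ, abs_two, le_div_iff₀ hδ]
    linarith
  nlinarith [sq_abs (2 * t / δ)]

theorem lt_abs_of_awayFromZeroCutoff_ne_zero {δ t : ℝ} (hδ : 0 < δ)
    (h : awayFromZeroCutoff δ t ≠ 0) : δ / 2 < |t| := by
  contrapose! h
  apply Real.smoothTransition.zero_of_nonpos
  have h' : |2 * t / δ| ≤ 1 := by
    rw [abs_div, abs_mul, abs_of_pos hδ, abs_two, div_le_one hδ]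
    linarith
  nlinarith [sq_abs (2 * t / δ), abs_nonneg (2 * t / δ)]

theorem abs_sub_awayFromZeroCutoff_mul_le {δ : ℝ} (hδ : 0 < δ) (t : ℝ) :
    |t - awayFromZeroCutoff δ t * t| ≤ δ := by
  rcases le_total δ |t| with h | h
  · simp [awayFromZeroCutoff_of_le hδ h, hδ.le]
  · have h0 : 0 ≤ awayFromZeroCutoff δ t := Real.smoothTransition.nonneg _
    have h1 : awayFromZeroCutoff δ t ≤ 1 := Real.smoothTransition.le_one _
    rw [← one_sub_mul, abs_mul, abs_of_nonneg (sub_nonneg.2 h1)]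
    nlinarith [abs_nonneg t]

theorem stmt11 (N : ℕ) (V : EuclideanSpace ℝ (Fin N) → ℝ)
    (hV : ContDiff ℝ (⊤ : ℕ∞) V) (hsupp : HasCompactSupport V) (δ : ℝ) (hδ : 0 < δ) :
    ∃ χ : EuclideanSpace ℝ (Fin N) → ℝ,
      ContDiff ℝ (⊤ : ℕ∞) χ ∧ HasCompactSupport χ ∧ (∀ x, χ x ∈ Set.Icc (0 : ℝ) 1) ∧
      (∀ x, |V x - χ x * V x| ≤ δ) ∧
      ∃ ρ : ℝ, 0 < ρ ∧ ∀ xp xm : EuclideanSpace ℝ (Fin N),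
        0 < χ xp * V xp → χ xm * V xm < 0 → ρ ≤ dist xp xm := by
  have huc : UniformContinuous V := hsupp.uniformContinuous_of_continuous hV.continuous
  obtain ⟨ρ, hρ, hdist⟩ := Metric.uniformContinuous_iff.1 huc δ hδ
  refine ⟨awayFromZeroCutoff δ ∘ V, (contDiff_awayFromZeroCutoff δ).comp hV,
    hsupp.comp_left (awayFromZeroCutoff_zero δ),
    fun x ↦ ⟨Real.smoothTransition.nonneg _, Real.smoothTransition.le_one _⟩,
    fun x ↦ abs_sub_awayFromZeroCutoff_mul_le hδ (V x), ρ, hρ, fun xp xm hp hm ↦ ?_⟩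
  have hVp : 0 < V xp := pos_of_mul_pos_right hp (Real.smoothTransition.nonneg _)
  have hVm : V xm < 0 := neg_of_mul_neg_right hm (Real.smoothTransition.nonneg _)
  have hlt_p := lt_abs_of_awayFromZeroCutoff_ne_zero hδ (left_ne_zero_of_mul hp.ne')
  have hlt_m := lt_abs_of_awayFromZeroCutoff_ne_zero hδ (left_ne_zero_of_mul hm.ne)
  rw [abs_of_pos hVp] at hlt_p
  rw [abs_of_neg hVm] at hlt_m
  by_contra! hlt
  have hclose := hdist hlt
  rw [Real.dist_eq] at hclose
  linarith [le_abs_self (V xp - V xm)]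
end
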